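/- arXiv:2207.00114 — 2 statements merged into one kernel-verified Lean document; each statement's English description precedes it below -/
import Mathlib

section
/- Let (c_p)_p be a bounded sequence of nonnegative real numbers indexed by primes. If the sequence (1/π(N)) · ∑_{p ≤ N, p prime} c_p converges as N → ∞, then (1/N) · ∑_{p ≤ N, p prime} c_p · log p also converges, and both limits are equal. The same holds with the roles of the two sequences exchanged. -/
open Filter Topology MeasureTheory FourierTransform Complex
open scoped SchwartzMap

/-- If the Laplace transform of a bounded function extends continuously to the closed right half
plane, then the convolutions of this function with the Fourier transforms of compactly supported
test functions tend to zero. -/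
theorem tendsto_integral_mul_fourier_of_laplace {h : ℝ → ℂ} {C : ℝ} {G : ℂ → ℂ}
    (hm : Measurable h) (hb : ∀ u, ‖h u‖ ≤ C) (hs : ∀ u ≤ 0, h u = 0)
    (hG : ContinuousOn G {s | 0 ≤ s.re})
    (hL : ∀ s : ℂ, 0 < s.re → ∫ u : ℝ, cexp (-s * u) * h u = G s)
    (φ : 𝓢(ℝ, ℂ)) (hφ : HasCompactSupport φ) :
    Tendsto (fun y : ℝ ↦ ∫ u : ℝ, h (y + u) * (𝓕 φ : 𝓢(ℝ, ℂ)) u) atTop (𝓝 0) := by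
  have hC : 0 ≤ C := (norm_nonneg _).trans (hb 0)
  have hdamp (δ : ℝ) (hδ : 0 ≤ δ) (u : ℝ) : ‖cexp (-(δ : ℂ) * u) * h u‖ ≤ ‖h u‖ := by
    rcases le_or_gt u 0 with hu | hu
    · simp [hs u hu]
    · rw [norm_mul, Complex.norm_exp]
      refine mul_le_of_le_one_left (norm_nonneg _) (Real.exp_le_one_iff.2 ?_)
      simp
      positivity
  have hdampint (δ : ℝ) (hδ : 0 < δ) : Integrable (fun u : ℝ ↦ cexp (-(δ : ℂ) * u) * h u) := by
    have h1 : IntegrableOn (fun u : ℝ ↦ C * Real.exp (-δ * u)) (Set.Ioi 0) :=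
      (exp_neg_integrableOn_Ioi 0 hδ).const_mul C
    rw [← integrable_indicator_iff measurableSet_Ioi] at h1
    refine h1.mono' (by fun_prop) (.of_forall fun u ↦ ?_)
    rcases le_or_gt u 0 with hu | hu
    · simp [hs u hu, hu]
    · rw [Set.indicator_of_mem (by exact hu), norm_mul, Complex.norm_exp, mul_comm]
      gcongr
      · exact hb u
      · simp
  have hfourier (y u : ℝ) : 𝓕 (fun t : ℝ ↦ cexp (2 * Real.pi * y * t * I) * φ t) u
      = (𝓕 φ : 𝓢(ℝ, ℂ)) (u - y) := by
    rw [SchwartzMap.fourier_coe, Real.fourier_eq', Real.fourier_eq']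
    congr 1 with t
    simp only [smul_eq_mul, ← mul_assoc, ← Complex.exp_add]
    congr 2
    simp
    ring
  have hGcont (δ : ℝ) (hδ : 0 ≤ δ) : Continuous fun t : ℝ ↦ G (δ + 2 * Real.pi * t * I) := by
    refine hG.comp_continuous (by fun_prop) fun t ↦ ?_
    simpa using hδ
  have hkey (y δ : ℝ) (hδ : 0 < δ) :
      ∫ t : ℝ, G (δ + 2 * Real.pi * t * I) * (cexp (2 * Real.pi * y * t * I) * φ t)
        = ∫ u : ℝ, cexp (-(δ : ℂ) * u) * h u * (𝓕 φ : 𝓢(ℝ, ℂ)) (u - y) := by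
    have hg : Integrable (fun t : ℝ ↦ cexp (2 * Real.pi * y * t * I) * φ t) := by
      refine φ.integrable.norm.mono' (by fun_prop) (.of_forall fun t ↦ ?_)
      rw [norm_mul, Complex.norm_exp]
      simp
    have := VectorFourier.integral_fourierIntegral_smul_eq_flip (L := innerₗ ℝ)
      Real.continuous_fourierChar continuous_inner (hdampint δ hδ) hg
    have hleft (t : ℝ) : G (δ + 2 * Real.pi * t * I)
        = 𝓕 (fun u : ℝ ↦ cexp (-(δ : ℂ) * u) * h u) t := by
      rw [← hL _ (by simpa using hδ), Real.fourier_eq']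
      congr 1 with u
      simp only [smul_eq_mul, ← mul_assoc, ← Complex.exp_add]
      congr 2
      simp
      ring
    simp_rw [hleft, ← hfourier]
    simpa only [flip_innerₗ, smul_eq_mul] using! this
  have hfi (y : ℝ) : Integrable fun u ↦ (𝓕 φ : 𝓢(ℝ, ℂ)) (u - y) := (𝓕 φ : 𝓢(ℝ, ℂ)).integrable.comp_sub_right y
  have hδ0 : Tendsto (fun δ : ℝ ↦ δ) (𝓝[>] 0) (𝓝 0) := nhdsWithin_le_nhds
  have hlimit (y : ℝ) :
      ∫ t : ℝ, G ((0 : ℝ) + 2 * Real.pi * t * I) * (cexp (2 * Real.pi * y * t * I) * φ t)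
        = ∫ u : ℝ, h u * (𝓕 φ : 𝓢(ℝ, ℂ)) (u - y) := by
    obtain ⟨B, hB⟩ : ∃ B, ∀ δ ∈ Set.Icc (0 : ℝ) 1, ∀ t ∈ tsupport φ,
        ‖G (δ + 2 * Real.pi * t * I)‖ ≤ B := by
      obtain ⟨B, hB⟩ := (isCompact_Icc.prod hφ).exists_bound_of_continuousOn
        (f := fun p : ℝ × ℝ ↦ G (p.1 + 2 * Real.pi * p.2 * I)) (s := Set.Icc (0 : ℝ) 1 ×ˢ tsupport φ)
        (hG.comp (by fun_prop) fun p hp ↦ by simpa using hp.1.1)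
      exact ⟨B, fun δ hδ t ht ↦ hB (δ, t) ⟨hδ, ht⟩⟩
    have h1 : Tendsto (fun δ : ℝ ↦ ∫ t : ℝ, G (δ + 2 * Real.pi * t * I) *
        (cexp (2 * Real.pi * y * t * I) * φ t)) (𝓝[>] 0) (𝓝 (∫ t : ℝ,
        G ((0 : ℝ) + 2 * Real.pi * t * I) * (cexp (2 * Real.pi * y * t * I) * φ t))) := by
      refine tendsto_integral_filter_of_dominated_convergence (fun t ↦ B * ‖φ t‖) ?_ ?_
        (φ.integrable.norm.const_mul B) (.of_forall fun t ↦ ?_)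
      · filter_upwards [self_mem_nhdsWithin] with δ hδ
        have := hGcont δ (le_of_lt hδ)
        exact this.aestronglyMeasurable.mul (by fun_prop)
      · filter_upwards [Ioo_mem_nhdsGT one_pos] with δ hδ
        refine .of_forall fun t ↦ ?_
        by_cases ht : t ∈ tsupport φ
        · rw [norm_mul, norm_mul, Complex.norm_exp]
          simp only [mul_re, mul_im, I_re, I_im, ofReal_re, ofReal_im, re_ofNat, im_ofNat]
          simpa using mul_le_mul_of_nonneg_right (hB δ ⟨hδ.1.le, hδ.2.le⟩ t ht) (norm_nonneg _)
        · simp [image_eq_zero_of_notMem_tsupport ht]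
      · refine Tendsto.mul_const _ ?_
        refine (hG _ (by simp)).tendsto.comp (tendsto_nhdsWithin_iff.2 ⟨?_, ?_⟩)
        · exact (((continuous_ofReal.tendsto 0).comp hδ0).add_const _)
        · filter_upwards [self_mem_nhdsWithin] with δ hδ
          simpa using le_of_lt hδ
    have h2 : Tendsto (fun δ : ℝ ↦ ∫ u : ℝ, cexp (-(δ : ℂ) * u) * h u * (𝓕 φ : 𝓢(ℝ, ℂ)) (u - y)) (𝓝[>] 0)
        (𝓝 (∫ u : ℝ, h u * (𝓕 φ : 𝓢(ℝ, ℂ)) (u - y))) := by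
      refine tendsto_integral_filter_of_dominated_convergence (fun u ↦ C * ‖(𝓕 φ : 𝓢(ℝ, ℂ)) (u - y)‖) ?_ ?_
        ((hfi y).norm.const_mul C) (.of_forall fun u ↦ ?_)
      · exact .of_forall fun δ ↦ AEStronglyMeasurable.mul (by fun_prop) (hfi y).1
      · filter_upwards [self_mem_nhdsWithin] with δ hδ
        refine .of_forall fun u ↦ ?_
        rw [norm_mul]
        gcongr
        exact (hdamp δ (le_of_lt hδ) u).trans (hb u)
      · refine Tendsto.mul_const _ ?_
        have : Tendsto (fun δ : ℝ ↦ cexp (-(δ : ℂ) * u) * h u) (𝓝 0)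
            (𝓝 (cexp (-((0 : ℝ) : ℂ) * u) * h u)) :=
          Continuous.tendsto (by fun_prop) _
        simpa [Function.comp_def] using this.comp hδ0
    refine tendsto_nhds_unique h1 (h2.congr' ?_)
    filter_upwards [self_mem_nhdsWithin] with δ hδ using (hkey y δ hδ).symm
  have hRL := (Real.zero_at_infty_fourier fun t : ℝ ↦
    G ((0 : ℝ) + 2 * Real.pi * t * I) * φ t).comp
      (tendsto_neg_atTop_atBot.mono_right atBot_le_cocompact)
  refine hRL.congr fun y ↦ ?_
  have hshift : ∫ u : ℝ, h (y + u) * (𝓕 φ : 𝓢(ℝ, ℂ)) u = ∫ u : ℝ, h u * (𝓕 φ : 𝓢(ℝ, ℂ)) (u - y) := by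
    rw [← integral_add_left_eq_self (μ := volume) (fun u ↦ h u * (𝓕 φ : 𝓢(ℝ, ℂ)) (u - y)) y]
    congr 1 with u
    rw [add_sub_cancel_left]
  rw [hshift, ← hlimit y, Function.comp_apply, Real.fourier_eq']
  congr 1 with t
  rw [smul_eq_mul, mul_left_comm]
  congr 3
  simp
  ring

/-- Test functions can be rescaled so that their Fourier transforms concentrate at the origin. -/
theorem exists_schwartzMap_comp_inv_mul {φ : 𝓢(ℝ, ℂ)} (hφ : HasCompactSupport φ) {R : ℝ}
    (hR : 0 < R) : ∃ ψ : 𝓢(ℝ, ℂ), HasCompactSupport ψ ∧ ∀ v, (𝓕 ψ : 𝓢(ℝ, ℂ)) v = R * (𝓕 φ : 𝓢(ℝ, ℂ)) (R * v) := by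
  have hsupp : HasCompactSupport fun t : ℝ ↦ φ (R⁻¹ • t) := hφ.comp_smul (inv_ne_zero hR.ne')
  refine ⟨hsupp.toSchwartzMap (φ.smooth'.comp (contDiff_const_smul R⁻¹)), hsupp, fun v ↦ ?_⟩
  rw [SchwartzMap.fourier_coe, SchwartzMap.fourier_coe, Real.fourier_eq', Real.fourier_eq']
  have := Measure.integral_comp_mul_left
    (fun t : ℝ ↦ cexp ((↑(-2 * Real.pi * inner ℝ t (R * v)) : ℂ) * I) • φ t) R⁻¹
  rw [inv_inv, abs_of_pos hR, real_smul] at this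
  rw [← this]
  congr 1 with t
  simp
  left
  congr 2
  field_simp [hR.ne']

theorem norm_integral_sub_integral_le {h : ℝ → ℂ} {C : ℝ} (hm : Measurable h)
    (hb : ∀ u, ‖h u‖ ≤ C) (ε y v : ℝ) :
    ‖(∫ w in 0..ε, h (y + v + w)) - ∫ w in 0..ε, h (y + w)‖ ≤ 2 * C * |v| := by
  have hint (a b : ℝ) : IntervalIntegrable h volume a b :=
    (intervalIntegrable_const (c := C)).mono_fun' hm.aestronglyMeasurable (.of_forall hb)
  rw [intervalIntegral.integral_comp_add_left h, intervalIntegral.integral_comp_add_left h,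
    intervalIntegral.integral_interval_sub_interval_comm (hint _ _) (hint _ _) (hint _ _)]
  have hconst (a b : ℝ) : ‖∫ w in a..b, h w‖ ≤ C * |b - a| :=
    intervalIntegral.norm_integral_le_of_norm_le_const fun w _ ↦ hb w
  have h1 := hconst (y + v + 0) (y + 0)
  have h2 := hconst (y + v + ε) (y + ε)
  rw [show y + 0 - (y + v + 0) = -v by ring, abs_neg] at h1
  rw [show y + ε - (y + v + ε) = -v by ring, abs_neg] at h2
  linarith [norm_sub_le (∫ w in (y + v + 0)..(y + 0), h w) (∫ w in (y + v + ε)..(y + ε), h w)]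

/-- If the convolutions of a bounded function with the Fourier transforms of test functions tend
to zero, then so do its integrals over intervals of fixed length. -/
theorem tendsto_intervalIntegral_of_fourier {h : ℝ → ℂ} {C : ℝ}
    (hm : Measurable h) (hb : ∀ u, ‖h u‖ ≤ C)
    (H : ∀ φ : 𝓢(ℝ, ℂ), HasCompactSupport φ →
      Tendsto (fun y : ℝ ↦ ∫ u : ℝ, h (y + u) * (𝓕 φ : 𝓢(ℝ, ℂ)) u) atTop (𝓝 0)) {ε : ℝ} (hε : 0 ≤ ε) :
    Tendsto (fun y : ℝ ↦ ∫ w in 0..ε, h (y + w)) atTop (𝓝 0) := by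
  have hC : 0 ≤ C := (norm_nonneg _).trans (hb 0)
  obtain ⟨φ, hφ, hφ0⟩ : ∃ φ : 𝓢(ℝ, ℂ), HasCompactSupport φ ∧ φ 0 = 1 := by
    let f : ContDiffBump (0 : ℝ) := ⟨1, 2, one_pos, one_lt_two⟩
    have hf : HasCompactSupport fun x ↦ (f x : ℂ) := f.hasCompactSupport.comp_left ofReal_zero
    refine ⟨hf.toSchwartzMap (ofRealCLM.contDiff.comp f.contDiff), hf, ?_⟩
    exact congrArg ((↑) : ℝ → ℂ) (f.one_of_mem_closedBall (x := 0) (by simp [f]))|>.trans ofReal_one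
  set k : 𝓢(ℝ, ℂ) := 𝓕 φ
  have hk1 : ∫ u, k u = 1 := by
    have : 𝓕⁻ (𝓕 φ : 𝓢(ℝ, ℂ)) = φ := by simp
    have h0 := congrArg (fun f : 𝓢(ℝ, ℂ) ↦ f 0) this
    simp only [SchwartzMap.fourierInv_coe, Real.fourierInv_eq', hφ0] at h0
    simpa using h0
  set D : ℝ → ℂ := fun y ↦ ∫ w in 0..ε, h (y + w) with hD
  have hDc : Continuous D := by
    have : LipschitzWith (2 * C).toNNReal D := .of_dist_le_mul fun x y ↦ by
      rw [dist_eq_norm, Real.dist_eq, Real.coe_toNNReal _ (by positivity)]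
      simpa [D] using norm_integral_sub_integral_le hm hb ε y (x - y)
    exact this.continuous
  have hDb (y : ℝ) : ‖D y‖ ≤ C * |ε - 0| :=
    intervalIntegral.norm_integral_le_of_norm_le_const fun w _ ↦ hb _
  have hsmooth {R : ℝ} (hR : 0 < R) :
      Tendsto (fun y : ℝ ↦ ∫ u : ℝ, k u * D (y + u / R)) atTop (𝓝 0) := by
    obtain ⟨ψ, hψ, hψk⟩ := exists_schwartzMap_comp_inv_mul hφ hR
    have hQ : Tendsto (fun y : ℝ ↦ ∫ u : ℝ, k u * h (y + u / R)) atTop (𝓝 0) := by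
      refine (H ψ hψ).congr fun y ↦ ?_
      have := Measure.integral_comp_mul_left (fun u : ℝ ↦ k u * h (y + u / R)) R
      rw [abs_of_pos (inv_pos.2 hR), real_smul, ofReal_inv, eq_inv_mul_iff_mul_eq₀
        (ofReal_ne_zero.2 hR.ne'), ← integral_const_mul] at this
      rw [← this]
      congr 1 with u
      rw [hψk, mul_div_cancel_left₀ _ hR.ne']
      ring
    have hswap (y : ℝ) : ∫ u : ℝ, k u * D (y + u / R)
        = ∫ w in 0..ε, ∫ u : ℝ, k u * h (y + w + u / R) := by
      rw [intervalIntegral.integral_of_le hε, integral_integral_swap]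
      · congr 1 with u
        rw [integral_const_mul]
        simp only [hD]
        rw [intervalIntegral.integral_of_le hε]
        simp only [add_right_comm]
      · refine Integrable.mono' (g := fun p : ℝ × ℝ ↦ C * ‖k p.2‖) ?_ ?_ (.of_forall fun p ↦ ?_)
        · exact Integrable.comp_snd (k.integrable.norm.const_mul C) _
        · have := k.continuous
          refine AEStronglyMeasurable.mul (by fun_prop) (Measurable.aestronglyMeasurable ?_)
          fun_prop
        · simp only [Function.uncurry, norm_mul]
          rw [mul_comm]
          gcongr
          exact hb _
    simp_rw [hswap]
    rw [Metric.tendsto_atTop] at hQ ⊢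
    intro η hη
    obtain ⟨Y, hY⟩ := hQ (η / (ε + 1)) (by positivity)
    refine ⟨Y, fun y hy ↦ ?_⟩
    rw [dist_zero_right]
    refine (intervalIntegral.norm_integral_le_of_norm_le_const (C := η / (ε + 1))
      fun w hw ↦ ?_).trans_lt ?_
    · rw [Set.uIoc_of_le hε] at hw
      simpa using (hY (y + w) (by linarith [hw.1])).le
    · rw [sub_zero, abs_of_nonneg hε, div_mul_eq_mul_div, div_lt_iff₀ (by positivity)]
      nlinarith
  set K : ℝ := ∫ u : ℝ, ‖k u‖ * (2 * C * |u|) with hK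
  have hKint : Integrable fun u : ℝ ↦ ‖k u‖ * (2 * C * |u|) := by
    refine ((k.integrable_pow_mul volume 1).const_mul (2 * C)).congr (.of_forall fun u ↦ ?_)
    simp
    ring
  have hK0 : 0 ≤ K := integral_nonneg fun u ↦ by positivity
  have hclose {R : ℝ} (hR : 0 < R) (y : ℝ) : ‖(∫ u : ℝ, k u * D (y + u / R)) - D y‖ ≤ K / R := by
    have h1 : Integrable fun u : ℝ ↦ k u * D (y + u / R) := by
      refine k.integrable.mul_bdd (c := C * |ε - 0|) ?_ (.of_forall fun u ↦ hDb _)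
      exact (hDc.comp (by fun_prop)).aestronglyMeasurable
    have h2 : D y = ∫ u : ℝ, k u * D y := by rw [integral_mul_const, hk1, one_mul]
    rw [h2, ← integral_sub h1 (k.integrable.mul_const _), hK, ← integral_div]
    refine norm_integral_le_of_norm_le (hKint.div_const R) (.of_forall fun u ↦ ?_)
    rw [← mul_sub, norm_mul, mul_div_assoc]
    gcongr
    refine (norm_integral_sub_integral_le hm hb ε y (u / R)).trans_eq ?_
    rw [abs_div, abs_of_pos hR]
    ring
  rw [Metric.tendsto_atTop]
  intro η hη
  have hR : 0 < 2 * (K + 1) / η := by positivity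
  obtain ⟨Y, hY⟩ := Metric.tendsto_atTop.1 (hsmooth hR) (η / 2) (by positivity)
  refine ⟨Y, fun y hy ↦ ?_⟩
  have h1 := hY y hy
  have h2 := hclose hR y
  rw [dist_zero_right] at h1 ⊢
  have h3 : K / (2 * (K + 1) / η) < η / 2 := by
    rw [div_lt_iff₀ hR]
    field_simp
    linarith
  have h4 := norm_sub_le (∫ u : ℝ, k u * D (y + u / (2 * (K + 1) / η)))
    ((∫ u : ℝ, k u * D (y + u / (2 * (K + 1) / η))) - D y)
  rw [sub_sub_cancel] at h4
  linarith

/-- A Tauberian condition recovering a limit from the limits of averages over short intervals. -/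
theorem tendsto_one_of_tendsto_intervalIntegral {B : ℝ → ℝ} (hB0 : ∀ u, 0 ≤ B u)
    (hB : Monotone fun u ↦ B u * Real.exp u)
    (H : ∀ ε > 0, Tendsto (fun y ↦ ∫ w in 0..ε, (B (y + w) - 1)) atTop (𝓝 0)) :
    Tendsto B atTop (𝓝 1) := by
  have hint (y a b : ℝ) : IntervalIntegrable (fun w ↦ B (y + w)) volume a b := by
    have h1 : Monotone fun w ↦ B (y + w) * Real.exp (y + w) :=
      fun w v hwv ↦ hB (add_le_add_right hwv y)
    refine ((h1.intervalIntegrable (μ := volume) (a := a) (b := b)).mul_continuousOn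
      (g := fun w ↦ Real.exp (-(y + w))) (by fun_prop)).congr fun w _ ↦ ?_
    simp [mul_assoc, ← Real.exp_add]
  have hconst (ε c : ℝ) : ∫ _ in 0..ε, c = ε * c := by simp
  have hsub (y ε : ℝ) : ∫ w in 0..ε, (B (y + w) - 1) = (∫ w in 0..ε, B (y + w)) - ε := by
    rw [intervalIntegral.integral_sub (hint y 0 ε) intervalIntegrable_const, hconst, mul_one]
  have hcmp {u v : ℝ} (huv : u ≤ v) {ε : ℝ} (hvu : v - u ≤ ε) : B u ≤ B v * Real.exp ε := by
    have h1 := hB huv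
    simp only at h1
    calc B u = B u * Real.exp u * Real.exp (-u) := by simp [mul_assoc, ← Real.exp_add]
      _ ≤ B v * Real.exp v * Real.exp (-u) := by gcongr
      _ = B v * Real.exp (v - u) := by rw [mul_assoc, ← Real.exp_add, sub_eq_add_neg]
      _ ≤ B v * Real.exp ε := by gcongr; exact hB0 v
  have hupper {ε : ℝ} (hε : 0 < ε) (y : ℝ) :
      B y ≤ Real.exp ε * (1 + (∫ w in 0..ε, (B (y + w) - 1)) / ε) := by
    have h1 : ∫ _ in 0..ε, B y * Real.exp (-ε) ≤ ∫ w in 0..ε, B (y + w) := by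
      refine intervalIntegral.integral_mono_on hε.le intervalIntegrable_const (hint y 0 ε)
        fun w hw ↦ ?_
      have := hcmp (u := y) (v := y + w) (by linarith [hw.1]) (ε := ε) (by linarith [hw.2])
      rwa [Real.exp_neg, ← div_eq_mul_inv, div_le_iff₀ (Real.exp_pos ε)]
    rw [hconst, Real.exp_neg] at h1
    rw [hsub, sub_div, div_self hε.ne', add_sub_cancel, mul_div_assoc', le_div_iff₀ hε]
    calc B y * ε = Real.exp ε * (ε * (B y * (Real.exp ε)⁻¹)) := by field_simp
      _ ≤ _ := by gcongr
  have hlower {ε : ℝ} (hε : 0 < ε) (y : ℝ) :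
      Real.exp (-ε) * (1 + (∫ w in 0..ε, (B (y - ε + w) - 1)) / ε) ≤ B y := by
    have h1 : ∫ w in 0..ε, B (y - ε + w) ≤ ∫ _ in 0..ε, B y * Real.exp ε :=
      intervalIntegral.integral_mono_on hε.le (hint _ 0 ε) intervalIntegrable_const
        fun w hw ↦ hcmp (by linarith [hw.2]) (by linarith [hw.1])
    rw [hconst] at h1
    rw [hsub, sub_div, div_self hε.ne', add_sub_cancel, mul_div_assoc', div_le_iff₀ hε,
      Real.exp_neg, inv_mul_le_iff₀ (Real.exp_pos ε)]
    linarith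
  refine tendsto_order.2 ⟨fun a ha ↦ ?_, fun b hb ↦ ?_⟩
  · obtain ⟨ε, hε, hε0⟩ := ((Continuous.tendsto' (by fun_prop : Continuous fun ε ↦ Real.exp (-ε))
      0 1 (by simp)).eventually (lt_mem_nhds ha)).filter_mono nhdsWithin_le_nhds |>.and
        (self_mem_nhdsWithin (s := Set.Ioi 0)) |>.exists
    have hlim := ((((H ε hε0).comp (tendsto_atTop_add_const_right _ (-ε) tendsto_id)).div_const
      ε).const_add 1).const_mul (Real.exp (-ε))
    rw [zero_div, add_zero, mul_one] at hlim
    filter_upwards [hlim.eventually (lt_mem_nhds hε)] with y hy using hy.trans_le (hlower hε0 y)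
  · obtain ⟨ε, hε, hε0⟩ := ((Continuous.tendsto' (by fun_prop : Continuous fun ε ↦ Real.exp ε)
      0 1 (by simp)).eventually (gt_mem_nhds hb)).filter_mono nhdsWithin_le_nhds |>.and
        (self_mem_nhdsWithin (s := Set.Ioi 0)) |>.exists
    have hlim := (((H ε hε0).div_const ε).const_add 1).const_mul (Real.exp ε)
    rw [zero_div, add_zero, mul_one] at hlim
    filter_upwards [hlim.eventually (gt_mem_nhds hε)] with y hy using (hupper hε0 y).trans_lt hy

open ArithmeticFunction in
theorem exists_continuousOn_LSeries_vonMangoldt_eq : ∃ A : ℂ → ℂ, ContinuousOn A {s | 1 ≤ s.re} ∧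
    ∀ s : ℂ, 1 < s.re → A s = LSeries (fun n ↦ (vonMangoldt n : ℂ)) s - 1 / (s - 1) := by
  refine ⟨vonMangoldt.LFunctionResidueClassAux (1 : ZMod 1),
    vonMangoldt.continuousOn_LFunctionResidueClassAux _, fun s hs ↦ ?_⟩
  rw [vonMangoldt.eqOn_LFunctionResidueClassAux isUnit_one hs]
  simp [vonMangoldt.residueClass, Subsingleton.elim _ (1 : ZMod 1)]

open ArithmeticFunction Chebyshev in
theorem LSeries_vonMangoldt_eq_mul_integral_psi {s : ℂ} (hs : 1 < s.re) :
    LSeries (fun n ↦ (vonMangoldt n : ℂ)) s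
      = s * ∫ u : ℝ in Set.Ioi 0, cexp (-(s - 1) * u) * (psi (Real.exp u) * Real.exp (-u) : ℝ) := by
  have hsum (x : ℝ) : psi x = ∑ k ∈ Finset.Icc 1 ⌊x⌋₊, vonMangoldt k := rfl
  have hO : (fun n ↦ ∑ k ∈ Finset.Icc 1 n, vonMangoldt k)
      =O[atTop] fun n ↦ (n : ℝ) ^ (1 : ℝ) := by
    refine .of_bound (Real.log 4 + 4) (.of_forall fun n ↦ ?_)
    have h1 := hsum n
    rw [Nat.floor_natCast] at h1
    rw [← h1, Real.norm_of_nonneg (psi_nonneg _), Real.rpow_one, Real.norm_natCast]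
    exact psi_le_const_mul_self n.cast_nonneg
  rw [LSeries_eq_mul_integral_of_nonneg _ zero_le_one hs hO fun n ↦ vonMangoldt_nonneg]
  congr 1
  rw [← Real.exp_zero, ← Real.image_exp_Ioi, integral_image_eq_integral_abs_deriv_smul
    measurableSet_Ioi (fun x _ ↦ (Real.hasDerivAt_exp x).hasDerivWithinAt)
    Real.exp_injective.injOn]
  congr 1 with u
  rw [← ofReal_sum, ← hsum, abs_of_pos (Real.exp_pos u), real_smul,
    cpow_def_of_ne_zero (ofReal_ne_zero.2 (Real.exp_pos u).ne'), ← ofReal_log (Real.exp_pos u).le,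
    Real.log_exp, ofReal_mul, ofReal_exp, ofReal_exp, mul_left_comm (cexp u), ← Complex.exp_add,
    mul_left_comm (cexp (-(s - 1) * u)), ← Complex.exp_add]
  congr 2
  push_cast
  ring

open ArithmeticFunction Chebyshev in
theorem tendsto_psi_exp_mul_exp_neg :
    Tendsto (fun u ↦ psi (Real.exp u) * Real.exp (-u)) atTop (𝓝 1) := by
  have hB0 (u : ℝ) : 0 ≤ psi (Real.exp u) * Real.exp (-u) :=
    mul_nonneg (psi_nonneg _) (by positivity)
  have hBle (u : ℝ) : psi (Real.exp u) * Real.exp (-u) ≤ Real.log 4 + 4 := by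
    rw [Real.exp_neg, ← div_eq_mul_inv, div_le_iff₀ (Real.exp_pos u)]
    exact psi_le_const_mul_self (Real.exp_pos u).le
  have hBm : Measurable fun u ↦ psi (Real.exp u) * Real.exp (-u) := by
    have := psi_mono.measurable
    fun_prop
  set B : ℝ → ℝ := fun u ↦ psi (Real.exp u) * Real.exp (-u) with hB
  set h : ℝ → ℂ := (Set.Ioi 0).indicator fun u ↦ ((B u - 1 : ℝ) : ℂ) with hh
  have hm : Measurable h := Measurable.indicator (by fun_prop) measurableSet_Ioi
  have hb (u : ℝ) : ‖h u‖ ≤ Real.log 4 + 4 := by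
    have : 0 < Real.log 4 := Real.log_pos (by norm_num)
    refine (norm_indicator_le_norm_self _ u).trans ?_
    rw [norm_real, Real.norm_eq_abs, abs_le]
    constructor <;> linarith [hB0 u, hBle u]
  obtain ⟨A, hA, hAeq⟩ := exists_continuousOn_LSeries_vonMangoldt_eq
  have hne {s : ℂ} (hs : 0 ≤ s.re) : s + 1 ≠ 0 := fun h0 ↦ by
    have := congrArg re h0
    simp at this
    linarith
  have hG : ContinuousOn (fun s ↦ (A (s + 1) - 1) / (s + 1)) {s | 0 ≤ s.re} := by
    refine ((hA.comp (by fun_prop) fun s hs ↦ ?_).sub continuousOn_const).div (by fun_prop)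
      fun s hs ↦ hne hs
    simpa using hs
  have hL (s : ℂ) (hs : 0 < s.re) :
      ∫ u : ℝ, cexp (-s * u) * h u = (A (s + 1) - 1) / (s + 1) := by
    have hre : (-s).re < 0 := by simpa using hs
    have hexp : IntegrableOn (fun u : ℝ ↦ cexp (-s * u)) (Set.Ioi 0) :=
      integrableOn_exp_mul_complex_Ioi hre 0
    have hs0 : s ≠ 0 := fun h0 ↦ by simp [h0] at hs
    have h1 : ∫ u : ℝ, cexp (-s * u) * h u
        = ∫ u : ℝ in Set.Ioi 0, (cexp (-s * u) * (B u : ℝ) - cexp (-s * u)) := by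
      rw [← integral_indicator measurableSet_Ioi]
      congr 1 with u
      by_cases hu : u ∈ Set.Ioi (0 : ℝ)
      · simp [hh, hu, mul_sub]
      · simp [hh, hu]
    have hBint : IntegrableOn (fun u : ℝ ↦ cexp (-s * u) * (B u : ℝ)) (Set.Ioi 0) := by
      refine hexp.mul_bdd (c := Real.log 4 + 4) (by fun_prop) (.of_forall fun u ↦ ?_)
      rw [norm_real, Real.norm_of_nonneg (hB0 u)]
      exact hBle u
    have h2 := LSeries_vonMangoldt_eq_mul_integral_psi (s := s + 1) (by simpa using hs)
    rw [add_sub_cancel_right] at h2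
    change _ = (s + 1) * ∫ u : ℝ in Set.Ioi 0, cexp (-s * u) * (B u : ℝ) at h2
    rw [h1, integral_sub hBint hexp, integral_exp_mul_complex_Ioi hre,
      hAeq _ (by simpa using hs), h2, add_sub_cancel_right]
    have := hne hs.le
    field_simp
    simp
    ring
  refine tendsto_one_of_tendsto_intervalIntegral hB0 ?_ fun ε hε ↦ ?_
  · intro u v huv
    simp only [hB, mul_assoc, ← Real.exp_add, neg_add_cancel, Real.exp_zero, mul_one]
    exact psi_mono (Real.exp_le_exp.2 huv)
  · have h1 := tendsto_intervalIntegral_of_fourier hm hb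
      (tendsto_integral_mul_fourier_of_laplace hm hb (fun u hu ↦ by simp [hh, hu]) hG hL) hε.le
    have h2 := (continuous_re.tendsto _).comp h1
    refine h2.congr' ?_
    filter_upwards [eventually_ge_atTop 0] with y hy
    rw [Function.comp_apply, ← ofReal_re (∫ w in 0..ε, (B (y + w) - 1)),
      ← intervalIntegral.integral_ofReal]
    congr 1
    refine intervalIntegral.integral_congr_ae (.of_forall fun w hw ↦ ?_)
    rw [Set.uIoc_of_le hε.le] at hw
    exact Set.indicator_of_mem (by exact add_pos_of_nonneg_of_pos hy hw.1) _

open Chebyshev in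
/-- The **prime number theorem** for the Chebyshev function `ψ`. -/
theorem tendsto_psi_div_self : Tendsto (fun x ↦ psi x / x) atTop (𝓝 1) := by
  refine (tendsto_psi_exp_mul_exp_neg.comp Real.tendsto_log_atTop).congr' ?_
  filter_upwards [eventually_gt_atTop 0] with x hx
  rw [Function.comp_apply, Real.exp_neg, Real.exp_log hx, div_eq_mul_inv]

open Chebyshev in
/-- The **prime number theorem** for the Chebyshev function `θ`. -/
theorem tendsto_theta_div_self : Tendsto (fun x ↦ theta x / x) atTop (𝓝 1) := by
  obtain ⟨C, hC⟩ := psi_sub_theta_le_mul_sqrt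
  have h0 : Tendsto (fun x : ℝ ↦ (psi x - theta x) / x) atTop (𝓝 0) := by
    refine squeeze_zero' (g := fun x ↦ C / √x) ?_ ?_
      (tendsto_const_nhds.div_atTop Real.tendsto_sqrt_atTop)
    · filter_upwards [eventually_ge_atTop 0] with x hx
      exact div_nonneg (sub_nonneg.2 (theta_le_psi x)) hx
    · filter_upwards [eventually_gt_atTop 0] with x hx
      have := Real.sqrt_pos.2 hx
      rw [div_le_div_iff₀ hx this]
      simpa [mul_assoc, Real.mul_self_sqrt hx.le] using mul_le_mul_of_nonneg_right (hC x) this.le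
  simpa [← sub_div] using tendsto_psi_div_self.sub h0

open Chebyshev in
theorem tendsto_primeCounting_mul_log_sub_theta_div :
    Tendsto (fun N : ℕ ↦ (Nat.primeCounting N * Real.log N - theta N) / N) atTop (𝓝 0) := by
  have h1 := primeCounting_sub_theta_div_log_isBigO.comp_tendsto tendsto_natCast_atTop_atTop
  obtain ⟨C, hC⟩ := h1.bound
  refine squeeze_zero_norm' (a := fun N : ℕ ↦ C / Real.log N) ?_
    (tendsto_const_nhds.div_atTop (Real.tendsto_log_atTop.comp tendsto_natCast_atTop_atTop))
  filter_upwards [hC, eventually_gt_atTop 1] with N hN hN1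
  have hlog : 0 < Real.log N := Real.log_pos (by exact_mod_cast hN1)
  have hN0 : (0 : ℝ) < N := by positivity
  simp only [Function.comp_apply, Nat.floor_natCast] at hN
  rw [Real.norm_of_nonneg (by positivity : 0 ≤ (N : ℝ) / Real.log N ^ 2)] at hN
  have h2 : (Nat.primeCounting N * Real.log N - theta N) / N
      = (Nat.primeCounting N - theta N / Real.log N) * (Real.log N / N) := by
    field_simp
  rw [h2, norm_mul, Real.norm_of_nonneg (by positivity : 0 ≤ Real.log N / N)]
  calc _ ≤ C * (N / Real.log N ^ 2) * (Real.log N / N) := by gcongr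
    _ = _ := by field_simp

theorem tendsto_primeCounting_mul_log_div_self :
    Tendsto (fun N : ℕ ↦ Nat.primeCounting N * Real.log N / N) atTop (𝓝 1) := by
  have := tendsto_primeCounting_mul_log_sub_theta_div.add
    (tendsto_theta_div_self.comp tendsto_natCast_atTop_atTop)
  simpa [← add_div] using this

theorem tendsto_sum_mul_log_sub_sum_mul_log {c : ℕ → ℝ} (hc : ∀ p, 0 ≤ c p) {M : ℝ}
    (hM : ∀ p, c p ≤ M) :
    Tendsto (fun N : ℕ ↦ ((∑ p ∈ (Finset.range (N + 1)).filter Nat.Prime, c p) * Real.log N -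
      ∑ p ∈ (Finset.range (N + 1)).filter Nat.Prime, c p * Real.log p) / N) atTop (𝓝 0) := by
  have hlog {N p : ℕ} (hp : p ∈ (Finset.range (N + 1)).filter Nat.Prime) :
      0 ≤ Real.log N - Real.log p := by
    rw [Finset.mem_filter, Finset.mem_range] at hp
    have := hp.2.pos
    exact sub_nonneg.2 (Real.log_le_log (by positivity) (by exact_mod_cast Nat.lt_succ_iff.1 hp.1))
  have hM' := tendsto_primeCounting_mul_log_sub_theta_div.const_mul M
  rw [mul_zero] at hM'
  refine squeeze_zero (fun N ↦ ?_) (fun N ↦ ?_) hM'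
  · rw [Finset.sum_mul, ← Finset.sum_sub_distrib]
    refine div_nonneg (Finset.sum_nonneg fun p hp ↦ ?_) N.cast_nonneg
    rw [← mul_sub]
    exact mul_nonneg (hc p) (hlog hp)
  · rw [← mul_div_assoc]
    gcongr
    rw [Finset.sum_mul, ← Finset.sum_sub_distrib, Chebyshev.theta_eq_sum_primesLE_log,
      ← Nat.primesLE_card_eq_primeCounting, ← nsmul_eq_mul, ← Finset.sum_const,
      ← Finset.sum_sub_distrib, Finset.mul_sum]
    refine Finset.sum_le_sum fun p hp ↦ ?_
    rw [← mul_sub]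
    exact mul_le_mul_of_nonneg_right (hM p) (hlog hp)

theorem stmt7 (c : ℕ → ℝ) (hc : ∀ p, 0 ≤ c p) (M : ℝ) (hM : ∀ p, c p ≤ M)
    (L : ℝ) :
    (Filter.Tendsto
        (fun N : ℕ =>
          (1 / (((Finset.range (N + 1)).filter Nat.Prime).card : ℝ)) *
            ∑ p ∈ (Finset.range (N + 1)).filter Nat.Prime, c p)
        Filter.atTop (nhds L) →
      Filter.Tendsto
        (fun N : ℕ =>
          (1 / (N : ℝ)) *
            ∑ p ∈ (Finset.range (N + 1)).filter Nat.Prime, c p * Real.log p)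
        Filter.atTop (nhds L)) ∧
    (Filter.Tendsto
        (fun N : ℕ =>
          (1 / (N : ℝ)) *
            ∑ p ∈ (Finset.range (N + 1)).filter Nat.Prime, c p * Real.log p)
        Filter.atTop (nhds L) →
      Filter.Tendsto
        (fun N : ℕ =>
          (1 / (((Finset.range (N + 1)).filter Nat.Prime).card : ℝ)) *
            ∑ p ∈ (Finset.range (N + 1)).filter Nat.Prime, c p)
        Filter.atTop (nhds L)) := by
  have hdiff := tendsto_sum_mul_log_sub_sum_mul_log hc hM
  have hcard (N : ℕ) : ((Finset.range (N + 1)).filter Nat.Prime).card = Nat.primeCounting N :=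
    Nat.primesLE_card_eq_primeCounting N
  simp only [hcard]
  have hpi := tendsto_primeCounting_mul_log_div_self
  have hev : ∀ᶠ N : ℕ in atTop, 0 < (Nat.primeCounting N : ℝ) ∧ 0 < Real.log N ∧ 0 < (N : ℝ) := by
    filter_upwards [hpi.eventually (lt_mem_nhds one_pos), eventually_gt_atTop 1] with N hN hN1
    refine ⟨Nat.cast_pos.2 (Nat.pos_of_ne_zero fun h0 ↦ ?_), Real.log_pos (by exact_mod_cast hN1),
      by positivity⟩
    simp [h0] at hN
  constructor <;> intro hL
  · have := (hL.mul hpi).sub hdiff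
    rw [mul_one, sub_zero] at this
    refine this.congr' ?_
    filter_upwards [hev] with N ⟨h1, h2, h3⟩
    field_simp
    ring
  · have := (hL.add hdiff).div hpi one_ne_zero
    rw [add_zero, div_one] at this
    refine this.congr' ?_
    filter_upwards [hev] with N ⟨h1, h2, h3⟩
    rw [Pi.div_apply]
    field_simp
    ring
end

section
/- Let f(x) ∈ ℤ[x] be a cubic polynomial. Then lim_{N→∞} (1/N) · ∑_{p ≤ N, p prime} (log p / p) · ∑_{x ∈ 𝔽_p} φ_p(f̄(x)) = 0. -/
open Polynomial

/-- The quadratic character of `ZMod p`: `0 ↦ 0`, nonzero squares `↦ 1`,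
nonsquares `↦ -1`. -/
noncomputable def quadChar (p : ℕ) (u : ZMod p) : ℤ := by
  classical exact if u = 0 then 0 else if IsSquare u then 1 else -1

section CubicCharacterSums

variable {F : Type*} [Field F]

/-- The value at `x` of the polynomial of degree at most three with coefficients `g`,
leading coefficient first. -/
def cubicEval (g : F × F × F × F) (x : F) : F :=
  g.1 * x ^ 3 + g.2.1 * x ^ 2 + g.2.2.1 * x + g.2.2.2

/-- The coefficients of `c * ((a * (x + t)) ^ 3 + A * (a * (x + t)) + B)`. -/
def affineOrbit (A B : F) (q : F × F × F) : F × F × F × F :=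
  (q.2.1 * q.1 ^ 3, 3 * (q.2.1 * q.1 ^ 3) * q.2.2,
    3 * (q.2.1 * q.1 ^ 3) * q.2.2 ^ 2 + A * (q.2.1 * q.1),
    q.2.1 * q.1 ^ 3 * q.2.2 ^ 3 + A * (q.2.1 * q.1) * q.2.2 + B * q.2.1)

theorem cubicEval_affineOrbit (A B a c t x : F) :
    cubicEval (affineOrbit A B (a, c, t)) x = c * cubicEval (1, 0, A, B) (a * (x + t)) := by
  simp only [cubicEval, affineOrbit]
  ring

variable [DecidableEq F]

theorem card_fiber_affineOrbit_le (h3 : (3 : F) ≠ 0) {A B : F} (hAB : A ≠ 0 ∨ B ≠ 0)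
    (S : Finset (F × F × F)) (hS : ∀ q ∈ S, q.1 ≠ 0 ∧ q.2.1 ≠ 0) (g : F × F × F × F) :
    (S.filter fun q => affineOrbit A B q = g).card ≤ 3 := by
  rcases (S.filter fun q => affineOrbit A B q = g).eq_empty_or_nonempty with h | ⟨q₀, hq₀⟩
  · simp [h]
  have key : ∀ q ∈ S.filter (fun q => affineOrbit A B q = g),
      ∀ r ∈ S.filter (fun q => affineOrbit A B q = g),
      q.2.1 * q.1 ^ 3 = r.2.1 * r.1 ^ 3 ∧ q.2.2 = r.2.2 ∧
      A * (q.2.1 * q.1) = A * (r.2.1 * r.1) ∧ B * q.2.1 = B * r.2.1 := by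
    rintro ⟨a, c, t⟩ hq ⟨a', c', t'⟩ hr
    obtain ⟨hqS, hq⟩ := Finset.mem_filter.1 hq
    obtain ⟨hrS, hr⟩ := Finset.mem_filter.1 hr
    obtain ⟨ha, hc⟩ := hS _ hqS
    have h := hq.trans hr.symm
    simp only [affineOrbit, Prod.mk.injEq] at h ha hc ⊢
    obtain ⟨h₁, h₂, h₃, h₄⟩ := h
    rw [← h₁] at h₂ h₃ h₄
    have ht : t = t' := mul_left_cancel₀ (mul_ne_zero h3 (mul_ne_zero hc (pow_ne_zero 3 ha))) h₂
    subst ht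
    have h₅ := add_left_cancel h₃
    rw [h₅] at h₄
    exact ⟨h₁, rfl, h₅, add_left_cancel h₄⟩
  obtain ⟨n, hn0, hn3, hn⟩ : ∃ n : ℕ, 0 < n ∧ n ≤ 3 ∧
      ∀ q ∈ S.filter (fun q => affineOrbit A B q = g), q.1 ^ n = q₀.1 ^ n := by
    obtain ⟨ha₀, hc₀⟩ := hS _ (Finset.mem_filter.1 hq₀).1
    rcases hAB with hA | hB
    · refine ⟨2, by norm_num, by norm_num, fun q hq => ?_⟩
      obtain ⟨h₁, -, h₂, -⟩ := key q hq q₀ hq₀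
      have h₃ := mul_left_cancel₀ hA h₂
      refine mul_left_cancel₀ (mul_ne_zero hc₀ ha₀) ?_
      linear_combination h₁ - q.1 ^ 2 * h₃
    · refine ⟨3, by norm_num, le_rfl, fun q hq => ?_⟩
      obtain ⟨h₁, -, -, h₂⟩ := key q hq q₀ hq₀
      have h₃ := mul_left_cancel₀ hB h₂
      refine mul_left_cancel₀ hc₀ ?_
      linear_combination h₁ - q.1 ^ 3 * h₃
  calc (S.filter fun q => affineOrbit A B q = g).card
      ≤ (nthRoots n (q₀.1 ^ n)).toFinset.card := by
        refine Finset.card_le_card_of_injOn Prod.fst (fun q hq => ?_) ?_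
        · simpa [mem_nthRoots hn0] using hn q hq
        · rintro ⟨a, c, t⟩ hq ⟨a', c', t'⟩ hr (rfl : a = a')
          obtain ⟨h₁, h₂, -, -⟩ := key _ hq _ hr
          have ha := (hS _ (Finset.mem_filter.1 hq).1).1
          have := mul_right_cancel₀ (pow_ne_zero 3 ha) h₁
          simp_all
    _ ≤ (nthRoots n (q₀.1 ^ n)).card := Multiset.toFinset_card_le _
    _ ≤ n := card_nthRoots _ _
    _ ≤ 3 := hn3

variable [Fintype F]

/-- The sum of the quadratic character over the values of a cubic. -/
def cubicCharSum (g : F × F × F × F) : ℤ :=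
  ∑ x : F, quadraticChar F (cubicEval g x)

theorem sum_quadraticChar_add_mul (hF : ringChar F ≠ 2) (u : F) {v : F} (hv : v ≠ 0) :
    ∑ t : F, quadraticChar F (u + t * v) = 0 := by
  rw [← quadraticChar_sum_zero hF]
  exact ((Equiv.mulRight₀ v hv).trans (Equiv.addLeft u)).sum_comp (fun y => quadraticChar F y)

/-- A point of evaluation distinct from the three others makes the correlation vanish. -/
theorem sum_quadraticChar_cubicEval_eq_zero (hF : ringChar F ≠ 2) {x a b c : F}
    (ha : x ≠ a) (hb : x ≠ b) (hc : x ≠ c) :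
    ∑ g : F × F × F × F, quadraticChar F (cubicEval g x) * (quadraticChar F (cubicEval g a) *
      quadraticChar F (cubicEval g b) * quadraticChar F (cubicEval g c)) = 0 := by
  set G : F × F × F × F → ℤ := fun g => quadraticChar F (cubicEval g x) *
    (quadraticChar F (cubicEval g a) * quadraticChar F (cubicEval g b) *
      quadraticChar F (cubicEval g c)) with hG
  let h : F × F × F × F := (1, -(a + b + c), a * b + b * c + c * a, -(a * b * c))
  have hval (t : F) (g : F × F × F × F) (y : F) :
      cubicEval (g + t • h) y = cubicEval g y + t * ((y - a) * (y - b) * (y - c)) := by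
    simp only [cubicEval, h, Prod.fst_add, Prod.snd_add, Prod.smul_fst, Prod.smul_snd,
      smul_eq_mul]
    ring
  have hshift (t : F) : ∑ g, G (g + t • h) = ∑ g, G g := 
    Equiv.sum_comp (Equiv.addRight (t • h)) G
  have hzero : ∑ t : F, ∑ g, G (g + t • h) = 0 := by
    rw [Finset.sum_comm]
    refine Finset.sum_eq_zero fun g _ => ?_
    simp only [hG, hval, sub_self, zero_mul, mul_zero, add_zero]
    rw [← Finset.sum_mul, sum_quadraticChar_add_mul hF _
      (mul_ne_zero (mul_ne_zero (sub_ne_zero.2 ha) (sub_ne_zero.2 hb)) (sub_ne_zero.2 hc)),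
      zero_mul]
  simp only [hshift, Finset.sum_const, Finset.card_univ, nsmul_eq_mul, mul_eq_zero,
    Nat.cast_eq_zero, Fintype.card_ne_zero, false_or] at hzero
  exact hzero

theorem abs_quadraticChar_le_one (u : F) : |quadraticChar F u| ≤ 1 := by
  rcases quadraticChar_isQuadratic F u with h | h | h <;> simp [h]

theorem sum_quadraticChar_cubicEval_le (hF : ringChar F ≠ 2) (a b c d : F) :
    ∑ g : F × F × F × F, quadraticChar F (cubicEval g a) * quadraticChar F (cubicEval g b) *
      quadraticChar F (cubicEval g c) * quadraticChar F (cubicEval g d) ≤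
    (Fintype.card F : ℤ) ^ 4 * ((if a = b then if c = d then 1 else 0 else 0) +
      (if a = c then if b = d then 1 else 0 else 0) +
      (if a = d then if b = c then 1 else 0 else 0)) := by
  have htriv : ∑ g : F × F × F × F, quadraticChar F (cubicEval g a) *
      quadraticChar F (cubicEval g b) * quadraticChar F (cubicEval g c) *
      quadraticChar F (cubicEval g d) ≤ (Fintype.card F : ℤ) ^ 4 := by
    calc _ ≤ ∑ g : F × F × F × F, (1 : ℤ) := by
          refine Finset.sum_le_sum fun g _ => (le_abs_self _).trans ?_
          simp only [abs_mul]
          exact mul_le_one₀ (mul_le_one₀ (mul_le_one₀ (abs_quadraticChar_le_one _) (abs_nonneg _)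
            (abs_quadraticChar_le_one _)) (abs_nonneg _) (abs_quadraticChar_le_one _))
            (abs_nonneg _) (abs_quadraticChar_le_one _)
      _ = _ := by simp; ring
  have hq : (0 : ℤ) ≤ (Fintype.card F : ℤ) ^ 4 := by positivity
  have hvanish : ∀ x y z w : F, x ≠ y → x ≠ z → x ≠ w →
      ∑ g : F × F × F × F, quadraticChar F (cubicEval g x) * (quadraticChar F (cubicEval g y) *
      quadraticChar F (cubicEval g z) * quadraticChar F (cubicEval g w)) = 0 :=
    fun x y z w => sum_quadraticChar_cubicEval_eq_zero hF
  by_cases h : (a ≠ b ∧ a ≠ c ∧ a ≠ d) ∨ (b ≠ a ∧ b ≠ c ∧ b ≠ d) ∨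
      (c ≠ a ∧ c ≠ b ∧ c ≠ d) ∨ (d ≠ a ∧ d ≠ b ∧ d ≠ c)
  · refine le_trans (le_of_eq ?_) (mul_nonneg hq (by positivity))
    rcases h with ⟨h₁, h₂, h₃⟩ | ⟨h₁, h₂, h₃⟩ | ⟨h₁, h₂, h₃⟩ | ⟨h₁, h₂, h₃⟩ <;>
    · rw [← hvanish _ _ _ _ h₁ h₂ h₃]
      exact Finset.sum_congr rfl fun g _ => by ring
  · refine htriv.trans (le_mul_of_one_le_right hq ?_)
    grind

/-- The fourth moment of the character sums over all polynomials of degree at most three. -/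
theorem sum_cubicCharSum_pow_four_le (hF : ringChar F ≠ 2) :
    ∑ g : F × F × F × F, cubicCharSum g ^ 4 ≤ 3 * (Fintype.card F : ℤ) ^ 6 := by
  calc ∑ g : F × F × F × F, cubicCharSum g ^ 4
      = ∑ g : F × F × F × F, ∑ a : F, ∑ b : F, ∑ c : F, ∑ d : F,
          quadraticChar F (cubicEval g a) * quadraticChar F (cubicEval g b) *
          quadraticChar F (cubicEval g c) * quadraticChar F (cubicEval g d) := by
        refine Finset.sum_congr rfl fun g _ => ?_
        simp only [← Finset.mul_sum, ← Finset.sum_mul, cubicCharSum]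
        ring
    _ = ∑ a : F, ∑ b : F, ∑ c : F, ∑ d : F, ∑ g : F × F × F × F,
          quadraticChar F (cubicEval g a) * quadraticChar F (cubicEval g b) *
          quadraticChar F (cubicEval g c) * quadraticChar F (cubicEval g d) := by
        rw [Finset.sum_comm]
        refine Finset.sum_congr rfl fun a _ => ?_
        rw [Finset.sum_comm]
        refine Finset.sum_congr rfl fun b _ => ?_
        rw [Finset.sum_comm]
        refine Finset.sum_congr rfl fun c _ => ?_
        rw [Finset.sum_comm]
    _ ≤ ∑ a : F, ∑ b : F, ∑ c : F, ∑ d : F, (Fintype.card F : ℤ) ^ 4 *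
          ((if a = b then if c = d then 1 else 0 else 0) +
          (if a = c then if b = d then 1 else 0 else 0) +
          (if a = d then if b = c then 1 else 0 else 0)) :=
        Finset.sum_le_sum fun a _ => Finset.sum_le_sum fun b _ => Finset.sum_le_sum fun c _ =>
          Finset.sum_le_sum fun d _ => sum_quadraticChar_cubicEval_le hF a b c d
    _ = 3 * (Fintype.card F : ℤ) ^ 6 := by
        have h₁ : ∑ a : F, ∑ b : F, ∑ c : F, ∑ d : F,
            (if a = b then if c = d then (1 : ℤ) else 0 else 0) = (Fintype.card F : ℤ) ^ 2 := by
          simp [sq]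
        have h₂ : ∑ a : F, ∑ b : F, ∑ c : F, ∑ d : F,
            (if a = c then if b = d then (1 : ℤ) else 0 else 0) = (Fintype.card F : ℤ) ^ 2 := by
          simp [sq]
        have h₃ : ∑ a : F, ∑ b : F, ∑ c : F, ∑ d : F,
            (if a = d then if b = c then (1 : ℤ) else 0 else 0) = (Fintype.card F : ℤ) ^ 2 := by
          simp [sq]
        simp only [← Finset.mul_sum, Finset.sum_add_distrib, h₁, h₂, h₃]
        ring

theorem abs_cubicCharSum_affineOrbit (A B t : F) {a c : F} (ha : a ≠ 0) (hc : c ≠ 0) :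
    |cubicCharSum (affineOrbit A B (a, c, t))| = |cubicCharSum (1, 0, A, B)| := by
  have h : ∑ x : F, quadraticChar F (cubicEval (1, 0, A, B) (a * (x + t))) =
      cubicCharSum (1, 0, A, B) :=
    ((Equiv.addRight t).trans (Equiv.mulLeft₀ a ha)).sum_comp
      (fun y => quadraticChar F (cubicEval (1, 0, A, B) y))
  have hone : |quadraticChar F c| = 1 := by
    rcases quadraticChar_dichotomy hc with h | h <;> simp [h]
  rw [cubicCharSum]
  simp only [cubicEval_affineOrbit, map_mul, ← Finset.mul_sum, h, abs_mul, hone, one_mul]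

theorem cubicCharSum_depressed_pow_four_le (hF : ringChar F ≠ 2) (h3 : (3 : F) ≠ 0) (A B : F) :
    cubicCharSum (1, 0, A, B) ^ 4 ≤ 36 * (Fintype.card F : ℤ) ^ 3 := by
  by_cases hAB : A ≠ 0 ∨ B ≠ 0
  · let S : Finset (F × F × F) := (Finset.univ.erase 0) ×ˢ (Finset.univ.erase 0) ×ˢ Finset.univ
    have hS : ∀ q ∈ S, q.1 ≠ 0 ∧ q.2.1 ≠ 0 := by simp [S]
    have hcard : (S.card : ℤ) = ((Fintype.card F : ℤ) - 1) ^ 2 * Fintype.card F := by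
      have : 1 ≤ Fintype.card F := Fintype.card_pos
      simp only [S, Finset.card_product, Finset.card_erase_of_mem (Finset.mem_univ _),
        Finset.card_univ]
      push_cast [this]
      ring
    have hfib : (S.card : ℤ) ≤ 3 * (S.image (affineOrbit A B)).card := by
      exact_mod_cast Finset.card_le_mul_card_image S 3
        fun g _ => card_fiber_affineOrbit_le h3 hAB S hS g
    have hmoment : (S.image (affineOrbit A B)).card * cubicCharSum (1, 0, A, B) ^ 4 ≤
        3 * (Fintype.card F : ℤ) ^ 6 := by
      calc _ = ∑ g ∈ S.image (affineOrbit A B), cubicCharSum g ^ 4 := by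
            rw [← nsmul_eq_mul, ← Finset.sum_const]
            refine Finset.sum_congr rfl fun g hg => ?_
            obtain ⟨⟨a, c, t⟩, hq, rfl⟩ := Finset.mem_image.1 hg
            have h := abs_cubicCharSum_affineOrbit A B t (hS _ hq).1 (hS _ hq).2
            exact ((by decide : Even 4).pow_abs _).symm.trans
              ((congrArg (· ^ 4) h.symm).trans ((by decide : Even 4).pow_abs _))
        _ ≤ ∑ g, cubicCharSum g ^ 4 :=
            Finset.sum_le_sum_of_subset_of_nonneg (Finset.subset_univ _)
              fun g _ _ => (by decide : Even 4).pow_nonneg _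
        _ ≤ _ := sum_cubicCharSum_pow_four_le hF
    have hq : (2 : ℤ) ≤ Fintype.card F := by exact_mod_cast Fintype.one_lt_card (α := F)
    set q : ℤ := (Fintype.card F : ℤ)
    set s : ℤ := cubicCharSum (1, 0, A, B) ^ 4
    have hs : 0 ≤ s := (by decide : Even 4).pow_nonneg _
    have h₁ : (q - 1) ^ 2 * q * s ≤ 9 * q ^ 6 := by
      rw [← hcard]
      nlinarith [mul_le_mul_of_nonneg_right hfib hs]
    have h₂ : q ^ 2 ≤ 4 * (q - 1) ^ 2 := by nlinarith
    have h₃ : q ^ 3 * s ≤ q ^ 3 * (36 * q ^ 3) := by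
      have := mul_le_mul_of_nonneg_right h₂ (mul_nonneg (by positivity : 0 ≤ q) hs)
      linarith
    exact le_of_mul_le_mul_left h₃ (by positivity)
  · obtain ⟨rfl, rfl⟩ : A = 0 ∧ B = 0 := by simpa using hAB
    have h : cubicCharSum ((1, 0, 0, 0) : F × F × F × F) = 0 := by
      rw [← quadraticChar_sum_zero hF]
      refine Finset.sum_congr rfl fun x _ => ?_
      rcases quadraticChar_isQuadratic F x with h | h | h <;>
        simp [cubicEval, h, -quadraticChar_apply]
    rw [h]
    positivity

/-- A bound of order `q ^ (3 / 4)` for the quadratic character sum of a cubic over a finite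
field with `q` elements, of characteristic at least five. -/
theorem cubicCharSum_pow_four_le (hF : ringChar F ≠ 2) (h3 : (3 : F) ≠ 0) {u : F} (hu : u ≠ 0)
    (v w z : F) : cubicCharSum (u, v, w, z) ^ 4 ≤ 36 * (Fintype.card F : ℤ) ^ 3 := by
  let t := v / (3 * u)
  let A := w / u - 3 * t ^ 2
  let B := z / u - t ^ 3 - A * t
  have h : affineOrbit A B (1, u, t) = (u, v, w, z) := by
    simp only [affineOrbit, Prod.mk.injEq, A, B, t]
    refine ⟨by ring, ?_, ?_, ?_⟩ <;> field_simp <;> ring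
  have habs := abs_cubicCharSum_affineOrbit A B t one_ne_zero hu
  rw [h] at habs
  rw [← (by decide : Even 4).pow_abs, habs, (by decide : Even 4).pow_abs]
  exact cubicCharSum_depressed_pow_four_le hF h3 A B

end CubicCharacterSums

theorem quadChar_eq_quadraticChar (p : ℕ) [Fact p.Prime] (u : ZMod p) :
    quadChar p u = quadraticChar (ZMod p) u := by
  simp only [quadChar, quadraticChar_apply, quadraticCharFun]
  congr

theorem sum_range_natCast_zmod {M : Type*} [AddCommMonoid M] (p : ℕ) [NeZero p]
    (G : ZMod p → M) : ∑ x ∈ Finset.range p, G x = ∑ x : ZMod p, G x := by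
  refine Finset.sum_bij (fun x _ => (x : ZMod p)) (fun _ _ => Finset.mem_univ _) ?_ ?_
    fun _ _ => rfl
  · intro a ha b hb hab
    rw [← ZMod.val_cast_of_lt (Finset.mem_range.1 ha), hab,
      ZMod.val_cast_of_lt (Finset.mem_range.1 hb)]
  · exact fun y _ => ⟨y.val, Finset.mem_range.2 y.val_lt, ZMod.natCast_zmod_val y⟩

theorem sum_quadChar_pow_four_le {f : ℤ[X]} (hf : f.degree = 3) {p : ℕ} (hp : p.Prime)
    (hp3 : 3 < p) (hlead : (f.coeff 3).natAbs < p) :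
    (∑ x ∈ Finset.range p,
      quadChar p ((f.map (Int.castRingHom (ZMod p))).eval (x : ZMod p))) ^ 4 ≤
      36 * (p : ℤ) ^ 3 := by
  have : Fact p.Prime := ⟨hp⟩
  have hchar : ringChar (ZMod p) ≠ 2 := by rw [ZMod.ringChar_zmod_n]; omega
  have h3 : (3 : ZMod p) ≠ 0 := by
    intro h
    have := (ZMod.natCast_eq_zero_iff 3 p).1 (by exact_mod_cast h)
    exact absurd (Nat.le_of_dvd (by norm_num) this) (by omega)
  have hcoeff : f.coeff 3 ≠ 0 := coeff_ne_zero_of_eq_degree hf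
  have hu : ((f.coeff 3 : ℤ) : ZMod p) ≠ 0 := by
    intro h
    have := Int.natAbs_dvd_natAbs.2 ((ZMod.intCast_zmod_eq_zero_iff_dvd _ p).1 h)
    exact absurd (Nat.le_of_dvd (Int.natAbs_pos.2 hcoeff) this) (by simpa using hlead)
  have hval (x : ZMod p) : (f.map (Int.castRingHom (ZMod p))).eval x =
      cubicEval ((f.coeff 3 : ZMod p), (f.coeff 2 : ZMod p), (f.coeff 1 : ZMod p),
        (f.coeff 0 : ZMod p)) x := by
    have hdeg : f.natDegree = 3 := natDegree_eq_of_degree_eq_some hf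
    rw [eval_map, eval₂_eq_sum_range, hdeg]
    simp only [Finset.sum_range_succ, Finset.sum_range_zero, cubicEval, eq_intCast]
    ring
  have hsum := sum_range_natCast_zmod p
    (fun x => quadChar p ((f.map (Int.castRingHom (ZMod p))).eval x))
  rw [hsum]
  simp only [hval, quadChar_eq_quadraticChar]
  simpa only [cubicCharSum, ZMod.card] using cubicCharSum_pow_four_le hchar h3 hu
    (f.coeff 2 : ZMod p) (f.coeff 1 : ZMod p) (f.coeff 0 : ZMod p)

theorem exists_abs_sum_quadChar_le {f : ℤ[X]} (hf : f.degree = 3) {ε : ℝ} (hε : 0 < ε) :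
    ∃ P : ℕ, ∀ p ≥ P, p.Prime →
      |((∑ x ∈ Finset.range p,
        quadChar p ((f.map (Int.castRingHom (ZMod p))).eval (x : ZMod p)) : ℤ) : ℝ)| ≤ ε * p := by
  obtain ⟨M, hM⟩ := exists_nat_ge (36 / ε ^ 4)
  refine ⟨M + 4 + (f.coeff 3).natAbs, fun p hpP hp => ?_⟩
  have hbound : ((∑ x ∈ Finset.range p,
      quadChar p ((f.map (Int.castRingHom (ZMod p))).eval (x : ZMod p)) : ℤ) : ℝ) ^ 4 ≤
      36 * (p : ℝ) ^ 3 := by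
    exact_mod_cast sum_quadChar_pow_four_le hf hp (by omega) (by omega)
  have hMp : (M : ℝ) ≤ p := by exact_mod_cast (by omega : M ≤ p)
  have hεp : 36 ≤ ε ^ 4 * p := by
    rw [mul_comm]
    exact (div_le_iff₀ (by positivity)).1 (hM.trans hMp)
  refine le_of_pow_le_pow_left₀ (n := 4) (by norm_num) (by positivity) ?_
  rw [(by decide : Even 4).pow_abs]
  calc _ ≤ 36 * (p : ℝ) ^ 3 := hbound
    _ ≤ ε ^ 4 * p * (p : ℝ) ^ 3 := by gcongr
    _ = (ε * p) ^ 4 := by ring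

/-- Weighted averages over the primes of a null sequence tend to zero, by Chebyshev's bound. -/
theorem tendsto_average_primes_log_mul {e : ℕ → ℝ}
    (he : ∀ ε > 0, ∃ P : ℕ, ∀ p ≥ P, p.Prime → |e p| ≤ ε * p) :
    Filter.Tendsto (fun N : ℕ => (1 / (N : ℝ)) *
      ∑ p ∈ (Finset.range (N + 1)).filter Nat.Prime, (Real.log p / p) * e p)
      Filter.atTop (nhds 0) := by
  rw [Metric.tendsto_atTop]
  intro ε hε
  have hlog4 : 0 < Real.log 4 := Real.log_pos (by norm_num)
  set δ := ε / (2 * Real.log 4)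
  have hδ : 0 < δ := by positivity
  obtain ⟨P, hP⟩ := he δ hδ
  set C := ∑ p ∈ Finset.range P, |(Real.log p / p) * e p|
  have hC : 0 ≤ C := Finset.sum_nonneg fun _ _ => abs_nonneg _
  obtain ⟨K, hK⟩ := exists_nat_gt (2 * C / ε)
  refine ⟨K + 1, fun N hN => ?_⟩
  have hN0 : 0 < (N : ℝ) := by exact_mod_cast (by omega : 0 < N)
  have hKN : (K : ℝ) ≤ N := by exact_mod_cast (by omega : K ≤ N)
  have htheta : ∑ p ∈ (Finset.range (N + 1)).filter Nat.Prime, Real.log p ≤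
      Real.log 4 * N := by
    refine le_trans (le_of_eq ?_) (Chebyshev.theta_le_log4_mul_x hN0.le)
    rw [Chebyshev.theta_eq_sum_Icc, Nat.floor_natCast, Finset.range_eq_Ico]
    rfl
  have hterm : ∀ p ∈ (Finset.range (N + 1)).filter Nat.Prime, |(Real.log p / p) * e p| ≤
      δ * Real.log p + if p ∈ Finset.range P then |(Real.log p / p) * e p| else 0 := by
    intro p hp
    have hprime := (Finset.mem_filter.1 hp).2
    have hp0 : (0 : ℝ) < p := by exact_mod_cast hprime.pos
    have hlog : 0 ≤ Real.log p := Real.log_natCast_nonneg p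
    split_ifs with h
    · linarith [mul_nonneg hδ.le hlog]
    · rw [abs_mul, abs_of_nonneg (div_nonneg hlog hp0.le), add_zero]
      calc Real.log p / p * |e p| ≤ Real.log p / p * (δ * p) := by
            gcongr
            exact hP p (by simpa using h) hprime
        _ = δ * Real.log p := by field_simp
  have hsum : |∑ p ∈ (Finset.range (N + 1)).filter Nat.Prime, (Real.log p / p) * e p| ≤
      δ * (Real.log 4 * N) + C := by
    refine (Finset.abs_sum_le_sum_abs _ _).trans ((Finset.sum_le_sum hterm).trans ?_)
    rw [Finset.sum_add_distrib, ← Finset.mul_sum]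
    gcongr
    rw [← Finset.sum_filter]
    exact Finset.sum_le_sum_of_subset_of_nonneg (fun p hp => (Finset.mem_filter.1 hp).2)
      fun _ _ _ => abs_nonneg _
  have hCN : 2 * C < ε * N := by
    rw [mul_comm ε]
    exact (div_lt_iff₀ hε).1 (hK.trans_le hKN)
  have hδN : δ * (Real.log 4 * N) = ε / 2 * N := by
    simp only [δ]
    field_simp
  rw [Real.dist_eq, sub_zero, abs_mul, abs_of_pos (by positivity), one_div, inv_mul_lt_iff₀ hN0]
  linarith

theorem stmt10 (f : Polynomial ℤ) (hf : f.degree = 3) :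
    Filter.Tendsto
      (fun N : ℕ =>
        (1 / (N : ℝ)) *
          ∑ p ∈ (Finset.range (N + 1)).filter Nat.Prime,
            (Real.log p / p) *
              ((∑ x ∈ Finset.range p,
                quadChar p ((f.map (Int.castRingHom (ZMod p))).eval (x : ZMod p)) : ℤ) : ℝ))
      Filter.atTop (nhds 0) := by
  exact tendsto_average_primes_log_mul fun ε hε => exists_abs_sum_quadChar_le hf hε
end
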